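/- Let ε ∈ [0,1) and let ρ_RC be a density matrix on R×C. Then the infimum, over all finite nonempty index types T and density matrices σ'_T on T, of Imax^ε(R : CT)_{ρ_RC ⊗ σ'_T} (smooth max-information across the bipartition R versus C×T) equals Imax^ε(R : C)_{ρ_RC}. -/

import Mathlib

open scoped Kronecker BigOperators
open Matrix
open scoped ComplexOrder Classical

noncomputable section

/-- A density matrix: positive semidefinite with unit trace. -/
def IsDensityMatrix {d : Type*} [Fintype d] (ρ : Matrix d d ℂ) : Prop :=
  ρ.PosSemidef ∧ ρ.trace = 1

/-- Loewner order on Hermitian matrices: `A ≤ B` iff `B - A` is positive semidefinite. -/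
def LoewnerLE {d : Type*} [Fintype d] (A B : Matrix d d ℂ) : Prop := (B - A).PosSemidef

/-- Partial trace over the second tensor factor. -/
def ptrace2 {d₁ d₂ : Type*} [Fintype d₂] (M : Matrix (d₁ × d₂) (d₁ × d₂) ℂ) :
    Matrix d₁ d₁ ℂ :=
  fun i i' => ∑ k, M (i, k) (i', k)

/-- Partial trace over the first tensor factor. -/
def ptrace1 {d₁ d₂ : Type*} [Fintype d₁] (M : Matrix (d₁ × d₂) (d₁ × d₂) ℂ) :
    Matrix d₂ d₂ ℂ :=
  fun j j' => ∑ k, M (k, j) (k, j')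

/-- Functional calculus for Hermitian matrices: apply `f` to the eigenvalues. -/
def hermCFC {d : Type*} [Fintype d] [DecidableEq d] (f : ℝ → ℝ) (A : Matrix d d ℂ) :
    Matrix d d ℂ :=
  if hA : A.IsHermitian then
    (hA.eigenvectorUnitary : Matrix d d ℂ) *
      Matrix.diagonal (fun i => (f (hA.eigenvalues i) : ℂ)) *
      (star (hA.eigenvectorUnitary : Matrix d d ℂ))
  else 0

/-- Matrix logarithm, base 2, applied to nonzero eigenvalues. -/
def matLog2 {d : Type*} [Fintype d] [DecidableEq d] (A : Matrix d d ℂ) : Matrix d d ℂ :=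
  hermCFC (Real.logb 2) A

/-- Positive semidefinite square root (via functional calculus). -/
def matSqrt {d : Type*} [Fintype d] [DecidableEq d] (A : Matrix d d ℂ) : Matrix d d ℂ :=
  hermCFC Real.sqrt A

/-- Support containment: the kernel of `σ` is contained in the kernel of `ρ`. -/
def SupportLE {d : Type*} [Fintype d] (ρ σ : Matrix d d ℂ) : Prop :=
  ∀ v : d → ℂ, σ.mulVec v = 0 → ρ.mulVec v = 0

/-- Relative entropy, base 2, as a real number (meaningful when supports are nested). -/
def relentR {d : Type*} [Fintype d] [DecidableEq d] (ρ σ : Matrix d d ℂ) : ℝ :=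
  ((ρ * matLog2 ρ).trace - (ρ * matLog2 σ).trace).re

/-- Relative entropy `D(ρ‖σ)`, base 2, valued in the extended reals: `+∞` unless
the support of `ρ` is contained in the support of `σ`. -/
def relent {d : Type*} [Fintype d] [DecidableEq d] (ρ σ : Matrix d d ℂ) : EReal :=
  if SupportLE ρ σ then ((relentR ρ σ : ℝ) : EReal) else ⊤

/-- Mutual information `I(A:B)_ρ = D(ρ_AB ‖ ρ_A ⊗ ρ_B)`. -/
def mutInfo {d₁ d₂ : Type*} [Fintype d₁] [Fintype d₂] [DecidableEq d₁] [DecidableEq d₂]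
    (ρ : Matrix (d₁ × d₂) (d₁ × d₂) ℂ) : EReal :=
  relent ρ (ptrace2 ρ ⊗ₖ ptrace1 ρ)

/-- Fidelity `F(ρ,σ) = Tr √(√σ ρ √σ)`. -/
def fidelity {d : Type*} [Fintype d] [DecidableEq d] (ρ σ : Matrix d d ℂ) : ℝ :=
  ((matSqrt (matSqrt σ * ρ * matSqrt σ)).trace).re

/-- Purified distance `P(ρ,σ) = √(1 - F(ρ,σ)²)`. -/
def pdist {d : Type*} [Fintype d] [DecidableEq d] (ρ σ : Matrix d d ℂ) : ℝ :=
  Real.sqrt (1 - (fidelity ρ σ) ^ 2)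

/-- Max-relative entropy `Dmax(ρ‖σ) = inf {λ : ρ ≤ 2^λ σ}`, valued in the extended reals. -/
def dmax {d : Type*} [Fintype d] (ρ σ : Matrix d d ℂ) : EReal :=
  sInf {x : EReal | ∃ l : ℝ, x = (l : EReal) ∧ LoewnerLE ρ (((2 : ℝ) ^ l) • σ)}

/-- Max-information `Imax(A:B)_ρ`. -/
def imax {d₁ d₂ : Type*} [Fintype d₁] [Fintype d₂]
    (ρ : Matrix (d₁ × d₂) (d₁ × d₂) ℂ) : EReal :=
  ⨅ σ : {σ : Matrix d₂ d₂ ℂ // IsDensityMatrix σ}, dmax ρ (ptrace2 ρ ⊗ₖ σ.1)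

/-- Smooth max-information `Imax^ε(A:B)_ρ`. -/
def imaxEps {d₁ d₂ : Type*} [Fintype d₁] [Fintype d₂] [DecidableEq d₁] [DecidableEq d₂]
    (ε : ℝ) (ρ : Matrix (d₁ × d₂) (d₁ × d₂) ℂ) : EReal :=
  ⨅ ρ' : {ρ' : Matrix (d₁ × d₂) (d₁ × d₂) ℂ // IsDensityMatrix ρ' ∧ pdist ρ ρ' ≤ ε},
    imax ρ'.1

/-- The `j`-th term of the convex split: `ρ` on `P` and the `j`-th copy of `Q`, and
`σ` on every other copy of `Q`. -/
def blockState {P Q : Type*} [Fintype Q] [DecidableEq Q]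
    (ρ : Matrix (P × Q) (P × Q) ℂ) (σ : Matrix Q Q ℂ) (n : ℕ) (j : Fin n) :
    Matrix (P × (Fin n → Q)) (P × (Fin n → Q)) ℂ :=
  fun x y => ρ (x.1, x.2 j) (y.1, y.2 j) * ∏ i ∈ Finset.univ.erase j, σ (x.2 i) (y.2 i)

/-- The convex-split state `τ = (1/n) Σ_j ρ_{PQ_j} ⊗ σ_{Q_1} ⊗ ⋯ ⊗ σ_{Q_n}` (omitting `j`). -/
def convexSplit {P Q : Type*} [Fintype Q] [DecidableEq Q]
    (ρ : Matrix (P × Q) (P × Q) ℂ) (σ : Matrix Q Q ℂ) (n : ℕ) :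
    Matrix (P × (Fin n → Q)) (P × (Fin n → Q)) ℂ :=
  ((n : ℂ)⁻¹) • ∑ j : Fin n, blockState ρ σ n j

/-- A finite nonempty index type. -/
structure FinIdx where
  carrier : Type
  [fin : Fintype carrier]
  [deq : DecidableEq carrier]
  [ne : Nonempty carrier]

attribute [instance] FinIdx.fin FinIdx.deq FinIdx.ne
/-! ### Hermitian functional calculus -/

theorem hermCFC_mul {d : Type*} [Fintype d] [DecidableEq d] (f g : ℝ → ℝ) (A : Matrix d d ℂ) :
    hermCFC f A * hermCFC g A = hermCFC (fun x => f x * g x) A := by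
  unfold hermCFC
  split_ifs with hA
  · have h : star (hA.eigenvectorUnitary : Matrix d d ℂ) * hA.eigenvectorUnitary = 1 :=
      Unitary.coe_star_mul_self _
    simp only [Matrix.mul_assoc]
    rw [← Matrix.mul_assoc (star (hA.eigenvectorUnitary : Matrix d d ℂ)), h, Matrix.one_mul,
      ← Matrix.mul_assoc (diagonal _), diagonal_mul_diagonal]
    simp
  · simp

theorem hermCFC_id {d : Type*} [Fintype d] [DecidableEq d] {A : Matrix d d ℂ}
    (hA : A.IsHermitian) : hermCFC (fun x => x) A = A := by
  rw [hermCFC, dif_pos hA]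
  conv_rhs => rw [hA.spectral_theorem]
  rfl

theorem posSemidef_hermCFC {d : Type*} [Fintype d] [DecidableEq d] {f : ℝ → ℝ}
    (hf : ∀ x, 0 ≤ f x) (A : Matrix d d ℂ) : (hermCFC f A).PosSemidef := by
  unfold hermCFC
  split_ifs with hA
  · exact (PosSemidef.diagonal fun i => by simpa using hf _).mul_mul_conjTranspose_same _
  · exact .zero

theorem hermCFC_congr {d : Type*} [Fintype d] [DecidableEq d] {f g : ℝ → ℝ} {A : Matrix d d ℂ}
    (hA : A.PosSemidef) (h : ∀ x, 0 ≤ x → f x = g x) : hermCFC f A = hermCFC g A := by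
  simp only [hermCFC, dif_pos hA.1, h _ (hA.eigenvalues_nonneg _)]

theorem posSemidef_matSqrt {d : Type*} [Fintype d] [DecidableEq d] (A : Matrix d d ℂ) :
    (matSqrt A).PosSemidef :=
  posSemidef_hermCFC Real.sqrt_nonneg A

theorem matSqrt_mul_self {d : Type*} [Fintype d] [DecidableEq d] {A : Matrix d d ℂ}
    (hA : A.PosSemidef) : matSqrt A * matSqrt A = A := by
  rw [matSqrt, hermCFC_mul, hermCFC_congr hA (g := fun x => x) fun x hx => Real.mul_self_sqrt hx,
    hermCFC_id hA.1]

/-- Polar decomposition: every matrix is a partial isometry times `√(GᴴG)`. -/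
theorem exists_partialIsometry_mul_matSqrt {n d : Type*} [Fintype n] [Fintype d] [DecidableEq d]
    (G : Matrix n d ℂ) :
    ∃ U : Matrix n d ℂ, G = U * matSqrt (Gᴴ * G) ∧ U * Uᴴ * U = U := by
  have hH := posSemidef_conjTranspose_mul_self G
  set H := Gᴴ * G with hHdef
  let p : ℝ → ℝ := fun x => (√x)⁻¹ * √x
  let N := hermCFC (fun x => (√x)⁻¹) H
  have hN : Nᴴ = N := (posSemidef_hermCFC (fun x => by positivity) H).1
  have hp : (hermCFC p H)ᴴ = hermCFC p H :=
    (posSemidef_hermCFC (fun x => by positivity) H).1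
  have hHp : H * hermCFC p H = H := by
    suffices h : hermCFC (fun x => x) H * hermCFC p H = hermCFC (fun x => x) H by
      rwa [hermCFC_id hH.1] at h
    rw [hermCFC_mul]
    refine hermCFC_congr hH fun x hx => ?_
    rcases hx.eq_or_lt with rfl | hx
    · simp
    · simp [p, inv_mul_cancel₀ (Real.sqrt_pos.2 hx).ne']
  have hGp : G * hermCFC p H = G := by
    rw [← sub_eq_zero, ← conjTranspose_mul_self_eq_zero]
    simp only [conjTranspose_sub, conjTranspose_mul, hp, Matrix.sub_mul, Matrix.mul_sub]
    rw [← hHdef, Matrix.mul_assoc _ Gᴴ G, ← Matrix.mul_assoc Gᴴ G, ← hHdef,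
      Matrix.mul_assoc _ Gᴴ, ← Matrix.mul_assoc Gᴴ, ← hHdef, hHp]
    simp
  refine ⟨G * N, ?_, ?_⟩
  · rw [Matrix.mul_assoc, matSqrt, hermCFC_mul]
    exact hGp.symm
  · have h1 : N * (H * N) = hermCFC p H := by
      suffices h : N * (hermCFC (fun x => x) H * N) = hermCFC p H by rwa [hermCFC_id hH.1] at h
      rw [hermCFC_mul, hermCFC_mul]
      refine hermCFC_congr hH fun x hx => ?_
      rcases hx.eq_or_lt with rfl | hx
      · simp [p]
      · have := (Real.sqrt_pos.2 hx).ne'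
        simp only [p]
        field_simp
        exact (Real.sq_sqrt hx.le).symm
    have h2 : N * hermCFC p H = N := by
      rw [hermCFC_mul]
      refine hermCFC_congr hH fun x hx => ?_
      rcases eq_or_ne (√x) 0 with h | h
      · simp [h]
      · simp [p, h]
    calc G * N * (G * N)ᴴ * (G * N) = G * (N * (N * (Gᴴ * G * N))) := by
          simp only [conjTranspose_mul, hN, Matrix.mul_assoc]
      _ = G * N := by rw [← hHdef, h1, h2]

/-! ### Fidelity as an optimum over factorizations -/

theorem trace_mul_conjTranspose_mul_self_re_nonneg {n d : Type*} [Fintype n] [Fintype d]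
    {S : Matrix d d ℂ} (hS : S.PosSemidef) (D : Matrix n d ℂ) :
    0 ≤ (S * (Dᴴ * D)).trace.re := by
  rw [← Matrix.mul_assoc, trace_mul_comm, ← Matrix.mul_assoc]
  exact (Complex.nonneg_iff.1 (hS.mul_mul_conjTranspose_same D).trace_nonneg).1

theorem trace_mul_partialIsometry_re_le {n d : Type*} [Fintype n] [Fintype d] [DecidableEq d]
    {S : Matrix d d ℂ} (hS : S.PosSemidef) {U : Matrix n d ℂ} (hU : U * Uᴴ * U = U) :
    (S * (Uᴴ * U)).trace.re ≤ S.trace.re := by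
  have h := trace_mul_conjTranspose_mul_self_re_nonneg hS (1 - Uᴴ * U)
  have h2 : (1 - Uᴴ * U)ᴴ * (1 - Uᴴ * U) = 1 - Uᴴ * U := by
    have : Uᴴ * U * (Uᴴ * U) = Uᴴ * U := by
      rw [Matrix.mul_assoc, ← Matrix.mul_assoc U, hU]
    simp [Matrix.sub_mul, Matrix.mul_sub, this]
  rw [h2, Matrix.mul_sub, trace_sub, Complex.sub_re, Matrix.mul_one] at h
  linarith

theorem trace_conjTranspose_mul_re_le_fidelity {n d : Type*} [Fintype n] [Fintype d]
    [DecidableEq d] (A B : Matrix n d ℂ) :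
    (Aᴴ * B).trace.re ≤ fidelity (Aᴴ * A) (Bᴴ * B) := by
  obtain ⟨V, hV, hV'⟩ := exists_partialIsometry_mul_matSqrt B
  set T := matSqrt (Bᴴ * B) with hT
  have hTh : Tᴴ = T := (posSemidef_matSqrt _).1
  obtain ⟨U, hU, hU'⟩ := exists_partialIsometry_mul_matSqrt (A * T)
  have hG : (A * T)ᴴ * (A * T) = T * (Aᴴ * A) * T := by
    simp only [conjTranspose_mul, hTh, Matrix.mul_assoc]
  rw [hG] at hU
  rw [fidelity, ← hT]
  have hS := posSemidef_matSqrt (T * (Aᴴ * A) * T)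
  set S := matSqrt (T * (Aᴴ * A) * T)
  have hSh : Sᴴ = S := hS.1
  have e1 : (Aᴴ * B).trace = (S * (Uᴴ * V)).trace := by
    conv_lhs => rw [hV, ← Matrix.mul_assoc, trace_mul_comm, ← Matrix.mul_assoc]
    rw [← Matrix.mul_assoc, ← hSh, ← conjTranspose_mul, ← hU, conjTranspose_mul, hTh]
  have e2 : (S * (Vᴴ * U)).trace.re = (S * (Uᴴ * V)).trace.re := by
    rw [← Complex.conj_re, starRingEnd_apply, ← trace_conjTranspose]
    simp only [conjTranspose_mul, conjTranspose_conjTranspose, hSh]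
    rw [trace_mul_comm]
  have h := trace_mul_conjTranspose_mul_self_re_nonneg hS (U - V)
  simp only [conjTranspose_sub, Matrix.sub_mul, Matrix.mul_sub, trace_sub, Complex.sub_re] at h
  have hu := trace_mul_partialIsometry_re_le hS hU'
  have hv := trace_mul_partialIsometry_re_le hS hV'
  rw [e1]
  linarith

theorem exists_factorization_trace_eq_fidelity {d : Type*} [Fintype d] [DecidableEq d]
    {ρ σ : Matrix d d ℂ} (hρ : ρ.PosSemidef) (hσ : σ.PosSemidef) :
    ∃ A B : Matrix (d ⊕ d) d ℂ, Aᴴ * A = ρ ∧ Bᴴ * B = σ ∧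
      (Aᴴ * B).trace.re = fidelity ρ σ := by
  have hX : (matSqrt ρ)ᴴ = matSqrt ρ := (posSemidef_matSqrt _).1
  have hY : (matSqrt σ)ᴴ = matSqrt σ := (posSemidef_matSqrt _).1
  have hXX := matSqrt_mul_self hρ
  have hYY := matSqrt_mul_self hσ
  obtain ⟨U, hU, hU'⟩ := exists_partialIsometry_mul_matSqrt (matSqrt ρ * matSqrt σ)
  rw [fidelity]
  set X := matSqrt ρ
  set Y := matSqrt σ
  have hG : (X * Y)ᴴ * (X * Y) = Y * ρ * Y := by
    simp only [conjTranspose_mul, hX, hY, ← hXX, Matrix.mul_assoc]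
  rw [hG] at hU
  have hS : (matSqrt (Y * ρ * Y))ᴴ = matSqrt (Y * ρ * Y) := (posSemidef_matSqrt _).1
  set S := matSqrt (Y * ρ * Y)
  have hproj : (1 - U * Uᴴ)ᴴ * (1 - U * Uᴴ) = 1 - U * Uᴴ := by
    have : U * Uᴴ * (U * Uᴴ) = U * Uᴴ := by rw [← Matrix.mul_assoc, hU']
    simp [Matrix.sub_mul, Matrix.mul_sub, this]
  refine ⟨fromRows (Uᴴ * X) ((1 - U * Uᴴ) * X), fromRows Y 0, ?_, ?_, ?_⟩
  · rw [conjTranspose_fromRows_eq_fromCols_conjTranspose, fromCols_mul_fromRows]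
    simp only [conjTranspose_mul, conjTranspose_conjTranspose, hX]
    rw [Matrix.mul_assoc X (1 - U * Uᴴ)ᴴ, ← Matrix.mul_assoc (1 - U * Uᴴ)ᴴ, hproj]
    simp only [Matrix.mul_sub, Matrix.sub_mul, Matrix.one_mul, hXX, Matrix.mul_assoc]
    abel
  · rw [conjTranspose_fromRows_eq_fromCols_conjTranspose, fromCols_mul_fromRows]
    simp [hY, hYY]
  · rw [conjTranspose_fromRows_eq_fromCols_conjTranspose, fromCols_mul_fromRows]
    simp only [conjTranspose_mul, conjTranspose_conjTranspose, hX, Matrix.mul_zero, add_zero]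
    have h1 : Y * X = S * Uᴴ := by
      rw [← hS, ← conjTranspose_mul, ← hU, conjTranspose_mul, hX, hY]
    have h2 : Uᴴ * U * S = S := by
      have h3 : S * (Uᴴ * (U * S)) = S * S := by
        rw [matSqrt_mul_self (hG ▸ posSemidef_conjTranspose_mul_self (X * Y)), ← hG, hU,
          conjTranspose_mul, hS, Matrix.mul_assoc]
      have h4 : U * (Uᴴ * (U * S)) = U * S := by
        rw [← Matrix.mul_assoc, ← Matrix.mul_assoc, hU']
      rw [← sub_eq_zero, ← conjTranspose_mul_self_eq_zero]
      simp [Matrix.sub_mul, Matrix.mul_sub, hS, Matrix.mul_assoc, h3, h4]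
    rw [trace_mul_comm, ← Matrix.mul_assoc, h1, Matrix.mul_assoc, trace_mul_comm, h2]

theorem fidelity_nonneg {d : Type*} [Fintype d] [DecidableEq d] (ρ σ : Matrix d d ℂ) :
    0 ≤ fidelity ρ σ :=
  (Complex.nonneg_iff.1 (posSemidef_matSqrt _).trace_nonneg).1

/-! ### Partial traces and relabellings -/

theorem ptrace2_conjTranspose_mul {n d t : Type*} [Fintype n] [Fintype t]
    (A B : Matrix n (d × t) ℂ) :
    ptrace2 (Aᴴ * B) = (of fun (i : n × t) j => A i.1 (j, i.2))ᴴ *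
      (of fun (i : n × t) j => B i.1 (j, i.2)) := by
  ext i j
  simp only [ptrace2, mul_apply, conjTranspose_apply, of_apply, Fintype.sum_prod_type]
  exact Finset.sum_comm

theorem trace_ptrace2 {d t : Type*} [Fintype d] [Fintype t]
    (M : Matrix (d × t) (d × t) ℂ) : (ptrace2 M).trace = M.trace := by
  simp [ptrace2, trace, Fintype.sum_prod_type]

theorem Matrix.PosSemidef.ptrace2 {d t : Type*} [Fintype d] [Fintype t]
    {M : Matrix (d × t) (d × t) ℂ} (hM : M.PosSemidef) : (_root_.ptrace2 M).PosSemidef := by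
  have h : (matSqrt M)ᴴ * matSqrt M = M := by
    rw [(posSemidef_matSqrt M).1, matSqrt_mul_self hM]
  rw [← h, ptrace2_conjTranspose_mul]
  exact posSemidef_conjTranspose_mul_self _

theorem IsDensityMatrix.ptrace2 {d t : Type*} [Fintype d] [Fintype t]
    {M : Matrix (d × t) (d × t) ℂ} (hM : IsDensityMatrix M) :
    IsDensityMatrix (_root_.ptrace2 M) :=
  ⟨hM.1.ptrace2, (trace_ptrace2 M).trans hM.2⟩

theorem IsDensityMatrix.submatrix {d d' : Type*} [Fintype d] [Fintype d']
    {M : Matrix d d ℂ} (hM : IsDensityMatrix M) (e : d' ≃ d) :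
    IsDensityMatrix (M.submatrix e e) :=
  ⟨hM.1.submatrix e, by
    rw [← hM.2]
    exact e.sum_comp fun i => M i i⟩

theorem fidelity_le_ptrace2 {d t : Type*} [Fintype d] [DecidableEq d] [Fintype t] [DecidableEq t]
    {ρ σ : Matrix (d × t) (d × t) ℂ} (hρ : ρ.PosSemidef) (hσ : σ.PosSemidef) :
    fidelity ρ σ ≤ fidelity (ptrace2 ρ) (ptrace2 σ) := by
  obtain ⟨A, B, hA, hB, h⟩ := exists_factorization_trace_eq_fidelity hρ hσ
  rw [← h, ← trace_ptrace2, ← hA, ← hB]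
  simp only [ptrace2_conjTranspose_mul]
  exact trace_conjTranspose_mul_re_le_fidelity _ _

theorem fidelity_le_submatrix {d d' : Type*} [Fintype d] [DecidableEq d] [Fintype d']
    [DecidableEq d'] {ρ σ : Matrix d d ℂ} (hρ : ρ.PosSemidef) (hσ : σ.PosSemidef) (e : d' ≃ d) :
    fidelity ρ σ ≤ fidelity (ρ.submatrix e e) (σ.submatrix e e) := by
  obtain ⟨A, B, hA, hB, h⟩ := exists_factorization_trace_eq_fidelity hρ hσ
  have ht : (Aᴴ * B).trace = ((A.submatrix id e)ᴴ * B.submatrix id e).trace :=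
    (e.sum_comp fun i => (Aᴴ * B) i i).symm
  rw [← h, ← hA, ← hB, ht]
  exact trace_conjTranspose_mul_re_le_fidelity (A.submatrix id e) (B.submatrix id e)

theorem pdist_le_pdist_of_fidelity_le {d d' : Type*} [Fintype d] [DecidableEq d] [Fintype d']
    [DecidableEq d'] {ρ σ : Matrix d d ℂ} {ρ' σ' : Matrix d' d' ℂ}
    (h : fidelity ρ σ ≤ fidelity ρ' σ') : pdist ρ' σ' ≤ pdist ρ σ := by
  have := fidelity_nonneg ρ σ
  unfold pdist
  gcongr

theorem dmax_le_dmax {d d' : Type*} [Fintype d] [Fintype d'] {ρ σ : Matrix d d ℂ}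
    {ρ' σ' : Matrix d' d' ℂ}
    (h : ∀ c : ℝ, LoewnerLE ρ (c • σ) → LoewnerLE ρ' (c • σ')) : dmax ρ' σ' ≤ dmax ρ σ :=
  sInf_le_sInf fun _ ⟨l, hx, hl⟩ => ⟨l, hx, h _ hl⟩

/-- Discarding the last factor of a tripartite matrix. -/
def discardLast {R C T : Type*} [Fintype T] (τ : Matrix (R × C × T) (R × C × T) ℂ) :
    Matrix (R × C) (R × C) ℂ :=
  ptrace2 (τ.submatrix (Equiv.prodAssoc R C T) (Equiv.prodAssoc R C T))

theorem fidelity_le_discardLast {R C T : Type*} [Fintype R] [Fintype C] [Fintype T]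
    [DecidableEq R] [DecidableEq C] [DecidableEq T] {ρ σ : Matrix (R × C × T) (R × C × T) ℂ}
    (hρ : ρ.PosSemidef) (hσ : σ.PosSemidef) :
    fidelity ρ σ ≤ fidelity (discardLast ρ) (discardLast σ) :=
  (fidelity_le_submatrix hρ hσ (Equiv.prodAssoc R C T)).trans
    (fidelity_le_ptrace2 (hρ.submatrix _) (hσ.submatrix _))

theorem imax_discardLast_le {R C T : Type*} [Fintype R] [Fintype C] [Fintype T]
    (τ : Matrix (R × C × T) (R × C × T) ℂ) : imax (discardLast τ) ≤ imax τ := by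
  refine le_iInf fun σ => iInf_le_of_le ⟨ptrace2 σ.1, σ.2.ptrace2⟩ (dmax_le_dmax fun c h => ?_)
  have h' := (h.submatrix (Equiv.prodAssoc R C T)).ptrace2
  unfold LoewnerLE
  convert h' using 1
  ext ⟨r, c⟩ ⟨r', c'⟩
  simp [discardLast, ptrace2, Fintype.sum_prod_type, Finset.mul_sum, Finset.sum_sub_distrib]

theorem imaxEps_le_of_ancilla {R C T : Type*} [Fintype R] [Fintype C] [Fintype T]
    [DecidableEq R] [DecidableEq C] [DecidableEq T] (ε : ℝ) {ρ : Matrix (R × C) (R × C) ℂ}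
    (hρ : IsDensityMatrix ρ) {σ : Matrix T T ℂ} (hσ : IsDensityMatrix σ) :
    imaxEps ε ρ ≤ imaxEps ε
      (reindex (Equiv.prodAssoc R C T) (Equiv.prodAssoc R C T) (ρ ⊗ₖ σ)) := by
  set e := Equiv.prodAssoc R C T
  set ω := reindex e e (ρ ⊗ₖ σ) with hω_def
  have hω : ω.PosSemidef := (hρ.1.kronecker hσ.1).submatrix e.symm
  have hd : discardLast ω = ρ := by
    ext i j
    have : ∑ k, σ k k = 1 := hσ.2
    simp only [discardLast, ptrace2, hω_def, reindex_apply, submatrix_apply, e,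
      Equiv.symm_apply_apply, kroneckerMap_apply, ← Finset.mul_sum, this, mul_one]
  refine le_iInf fun τ => iInf_le_of_le ⟨discardLast τ.1, (τ.2.1.submatrix _).ptrace2, ?_⟩
    (imax_discardLast_le _)
  have h := pdist_le_pdist_of_fidelity_le (fidelity_le_discardLast hω τ.2.1.1)
  rw [hd] at h
  exact h.trans τ.2.2

theorem imax_submatrix_le {R C C' : Type*} [Fintype R] [Fintype C] [Fintype C']
    (ρ : Matrix (R × C) (R × C) ℂ) (e : C' ≃ C) :
    imax (ρ.submatrix ((Equiv.refl R).prodCongr e) ((Equiv.refl R).prodCongr e)) ≤ imax ρ := by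
  refine le_iInf fun σ => iInf_le_of_le ⟨_, σ.2.submatrix e⟩ (dmax_le_dmax fun c h => ?_)
  have h' := h.submatrix ((Equiv.refl R).prodCongr e)
  unfold LoewnerLE
  convert h' using 1
  ext ⟨r, c⟩ ⟨r', c'⟩
  have hs : ∑ k, ρ (r, e k) (r', e k) = ∑ k, ρ (r, k) (r', k) :=
    e.sum_comp fun k => ρ (r, k) (r', k)
  simp [ptrace2, hs]

theorem imaxEps_submatrix_le {R C C' : Type*} [Fintype R] [Fintype C] [Fintype C']
    [DecidableEq R] [DecidableEq C] [DecidableEq C'] (ε : ℝ) {ρ : Matrix (R × C) (R × C) ℂ}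
    (hρ : IsDensityMatrix ρ) (e : C' ≃ C) :
    imaxEps ε (ρ.submatrix ((Equiv.refl R).prodCongr e) ((Equiv.refl R).prodCongr e)) ≤
      imaxEps ε ρ :=
  le_iInf fun τ => iInf_le_of_le ⟨_, τ.2.1.submatrix _,
    (pdist_le_pdist_of_fidelity_le (fidelity_le_submatrix hρ.1 τ.2.1.1 _)).trans τ.2.2⟩
    (imax_submatrix_le τ.1 e)

/-- Appending an uncorrelated ancilla does not change the smooth max-information:
inf over finite nonempty T and densities σ'_T of Imax^ε(R : CT)_{ρ_RC ⊗ σ'_T}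
equals Imax^ε(R : C)_{ρ_RC}. -/
theorem imaxEps_ancilla {R C : Type} [Fintype R] [Fintype C]
    [DecidableEq R] [DecidableEq C] [Nonempty R] [Nonempty C]
    (ε : ℝ) (hε0 : 0 ≤ ε) (hε1 : ε < 1)
    (ρ : Matrix (R × C) (R × C) ℂ) (hρ : IsDensityMatrix ρ) :
    (⨅ (T : FinIdx) (σ' : {m : Matrix T.carrier T.carrier ℂ // IsDensityMatrix m}),
        imaxEps ε
          (Matrix.reindex (Equiv.prodAssoc R C T.carrier) (Equiv.prodAssoc R C T.carrier)
            (ρ ⊗ₖ σ'.1)))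
      = imaxEps ε ρ := by
  refine le_antisymm ?_ (le_iInf₂ fun T σ => imaxEps_le_of_ancilla ε hρ σ.2)
  refine iInf₂_le_of_le ⟨Unit⟩ ⟨1, PosSemidef.one, by simp⟩ ?_
  convert imaxEps_submatrix_le ε hρ (Equiv.prodUnique C Unit) using 2
  ext ⟨r, c, _⟩ ⟨r', c', _⟩
  simp [reindex_apply]

end
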